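/- Let 1<p<∞, let L>0, and let 𝓛 = {ξ ∈ L¹(Π) ∩ L^p(Π) : ξ ≥ 0, I(ξ) ≤ L, ‖ξ‖₁ ≤ L, ‖ξ‖_p ≤ L}. Then the kinetic energy E is Lipschitz continuous on 𝓛 with respect to the L¹ norm: there is a constant K (depending on p and L) such that |E(ξ) − E(η)| ≤ K ‖ξ − η‖₁ for all ξ, η ∈ 𝓛. -/

import Mathlib

open MeasureTheory Real Filter Topology

noncomputable section

/-- The open upper half-plane Π. -/
def UHP : Set (ℝ × ℝ) := {x | 0 < x.2}

/-- Planar Lebesgue measure restricted to the upper half-plane. -/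
def μUH : Measure (ℝ × ℝ) := MeasureTheory.volume.restrict UHP

/-- Squared Euclidean distance in the plane. -/
def sqdist (x y : ℝ × ℝ) : ℝ := (x.1 - y.1) ^ 2 + (x.2 - y.2) ^ 2

/-- Euclidean distance in the plane. -/
def euclDist (x y : ℝ × ℝ) : ℝ := Real.sqrt (sqdist x y)

/-- The Green's function of −Δ in the upper half-plane:
`G(x,y) = (1/(4π)) log(1 + 4 x₂ y₂ / |x−y|²)`. -/
def greenG (x y : ℝ × ℝ) : ℝ :=
  (4 * π)⁻¹ * Real.log (1 + 4 * x.2 * y.2 / sqdist x y)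

/-- The stream-function operator `𝒢ζ(x) = ∫_Π G(x,y) ζ(y) dy`. -/
def Gop (ζ : ℝ × ℝ → ℝ) (x : ℝ × ℝ) : ℝ := ∫ y, greenG x y * ζ y ∂μUH

/-- Kinetic energy `E(ζ) = (1/2) ∫_Π ζ 𝒢ζ`. -/
def energy (ζ : ℝ × ℝ → ℝ) : ℝ := (1 / 2) * ∫ x, ζ x * Gop ζ x ∂μUH

/-- Impulse `I(ζ) = ∫_Π ζ(y) y₂ dy`. -/
def impulse (ζ : ℝ × ℝ → ℝ) : ℝ := ∫ y, ζ y * y.2 ∂μUH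

/-- The `L^p(Π)` norm, as a real number. -/
def lpN (p : ℝ) (ζ : ℝ × ℝ → ℝ) : ℝ := (eLpNorm ζ (ENNReal.ofReal p) μUH).toReal

/-- `f ⪯ g` : `∫ (f−a)₊ ≤ ∫ (g−a)₊` for every `a > 0`. -/
def prec (f g : ℝ × ℝ → ℝ) : Prop :=
  ∀ a : ℝ, 0 < a → ∫ x, max (f x - a) 0 ∂μUH ≤ ∫ x, max (g x - a) 0 ∂μUH

/-- `f` is a rearrangement of `g` on Π. -/
def IsRearr (f g : ℝ × ℝ → ℝ) : Prop :=
  ∀ a : ℝ, 0 < a → μUH {x | a < f x} = μUH {x | a < g x}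

/-- Membership of the relaxed constraint class `𝒲(ζ₀)`. -/
def memW (ζ₀ ζ : ℝ × ℝ → ℝ) : Prop :=
  (∀ x, 0 ≤ ζ x) ∧ Integrable ζ μUH ∧ prec ζ ζ₀

/-- `𝒲(ζ₀, ≤ i₀)`. -/
def Wle (ζ₀ : ℝ × ℝ → ℝ) (i₀ : ℝ) : Set (ℝ × ℝ → ℝ) :=
  {ζ | memW ζ₀ ζ ∧ impulse ζ ≤ i₀}

/-- `𝒲(ζ₀, i₀)`. -/
def Weq (ζ₀ : ℝ × ℝ → ℝ) (i₀ : ℝ) : Set (ℝ × ℝ → ℝ) :=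
  {ζ | memW ζ₀ ζ ∧ impulse ζ = i₀}

/-- Membership of `ℛ⁺(ζ₀)`: restrictions of rearrangements of `ζ₀`. -/
def memRplus (ζ₀ ζ : ℝ × ℝ → ℝ) : Prop :=
  ∃ ξ : ℝ × ℝ → ℝ, ∃ A : Set (ℝ × ℝ), IsRearr ξ ζ₀ ∧ MeasurableSet A ∧
    ζ = A.indicator ξ

/-- Steiner symmetry about the `x₂`-axis. -/
def SteinerSym (ζ : ℝ × ℝ → ℝ) : Prop :=
  ∀ᵐ t ∂(MeasureTheory.volume.restrict (Set.Ioi (0 : ℝ))),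
    (∀ s : ℝ, ζ (-s, t) = ζ (s, t)) ∧
    (∀ s₁ s₂ : ℝ, 0 ≤ s₁ → s₁ ≤ s₂ → ζ (s₂, t) ≤ ζ (s₁, t))

/-- The decreasing rearrangement `ζ^Δ(s) = inf {a > 0 : |{ζ > a}| ≤ s}`. -/
def decRearr (ζ : ℝ × ℝ → ℝ) (s : ℝ) : ℝ :=
  sInf {a : ℝ | 0 < a ∧ μUH {x | a < ζ x} ≤ ENNReal.ofReal s}

/-- The norm `‖ζ‖_{𝔛^p} = |I(ζ)| + ‖ζ‖₁ + ‖ζ‖_p`. -/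
def XpNorm (p : ℝ) (ζ : ℝ × ℝ → ℝ) : ℝ := |impulse ζ| + lpN 1 ζ + lpN p ζ

/-- Distance to a set of functions in the `𝔛^p` norm. -/
def XpDist (p : ℝ) (ζ : ℝ × ℝ → ℝ) (S : Set (ℝ × ℝ → ℝ)) : ℝ :=
  sInf ((fun σ => XpNorm p fun x => ζ x - σ x) '' S)


/-- One-dimensional integrable singularity `|s|^(-1/2)` on `(-1,1)`. -/
def phiAux (s : ℝ) : ℝ := (Set.Ioo (-1 : ℝ) 1).indicator (fun s => |s| ^ (-(1 / 2) : ℝ)) s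

/-- Indicator of `(-1,1)`. -/
def psiAux (s : ℝ) : ℝ := (Set.Ioo (-1 : ℝ) 1).indicator (fun _ => (1 : ℝ)) s

/-- Dominating function for the singular part of the kernel. -/
def hAux (q : ℝ) (x y : ℝ × ℝ) : ℝ :=
  if |x.1 - y.1| < 1 ∧ |x.2 - y.2| < 1 then 2 * q * |x.1 - y.1| ^ (-(1 / (2 * q))) else 0

theorem phiAux_integrable : Integrable phiAux volume := by
  unfold phiAux
  have h0 : IntegrableOn (fun s : ℝ => |s| ^ (-(1 / 2) : ℝ)) (Set.Ioc 0 1) volume := by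
    have := (intervalIntegral.intervalIntegrable_rpow' (a := 0) (b := 1)
      (r := (-(1 / 2) : ℝ)) (by norm_num))
    rw [intervalIntegrable_iff_integrableOn_Ioc_of_le zero_le_one] at this
    refine this.congr_fun (fun s hs => ?_) measurableSet_Ioc
    simp only [abs_of_pos hs.1]
  have h1 : IntegrableOn (fun s : ℝ => |s| ^ (-(1 / 2) : ℝ)) (Set.Ico (-1) 0) volume := by
    have := h0.comp_neg
    simpa using this
  have h00 : IntegrableOn (fun s : ℝ => |s| ^ (-(1 / 2) : ℝ)) {0} volume :=
    integrableOn_singleton (by simp) (by simp)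
  have h2 := h1.union (h0.union h00)
  rw [integrable_indicator_iff measurableSet_Ioo]
  refine h2.mono_set ?_
  intro s hs
  rcases lt_trichotomy s 0 with h | h | h
  · left; exact ⟨hs.1.le, h⟩
  · right; right; simp [h]
  · right; left; exact ⟨h, hs.2.le⟩

theorem psiAux_integrable : Integrable psiAux volume := by
  unfold psiAux
  rw [integrable_indicator_iff measurableSet_Ioo]
  exact integrableOn_const (by simp)

theorem phipsi_integrable : Integrable (fun y : ℝ × ℝ => phiAux y.1 * psiAux y.2) volume :=
  phiAux_integrable.mul_prod psiAux_integrable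

theorem phipsi_nonneg (y : ℝ × ℝ) : 0 ≤ phiAux y.1 * psiAux y.2 := by
  unfold phiAux psiAux
  apply mul_nonneg
  · exact Set.indicator_nonneg (fun s _ => by positivity) _
  · exact Set.indicator_nonneg (fun s _ => by positivity) _

theorem hAux_nonneg {q : ℝ} (hq : 0 < q) (x y : ℝ × ℝ) : 0 ≤ hAux q x y := by
  unfold hAux
  split_ifs <;> positivity

theorem hAux_rpow {q : ℝ} (hq : 0 < q) (x y : ℝ × ℝ) :
    hAux q x y ^ q = (2 * q) ^ q * (phiAux (x.1 - y.1) * psiAux (x.2 - y.2)) := by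
  unfold hAux phiAux psiAux
  split_ifs with h
  · rw [Set.indicator_of_mem (by simpa [abs_lt] using h.1),
      Set.indicator_of_mem (by simpa [abs_lt] using h.2),
      Real.mul_rpow (by positivity) (by positivity), ← Real.rpow_mul (abs_nonneg _), mul_one]
    congr 2
    field_simp
  · rw [Real.zero_rpow hq.ne']
    by_cases h1 : |x.1 - y.1| < 1
    · have h2 : ¬ |x.2 - y.2| < 1 := fun h2 => h ⟨h1, h2⟩
      rw [Set.indicator_of_notMem (s := Set.Ioo (-1 : ℝ) 1) (a := x.2 - y.2)
        (by rw [Set.mem_Ioo, ← abs_lt]; exact h2)]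
      simp
    · rw [Set.indicator_of_notMem (s := Set.Ioo (-1 : ℝ) 1) (a := x.1 - y.1)
        (by rw [Set.mem_Ioo, ← abs_lt]; exact h1)]
      simp

theorem greenG_nonneg {x y : ℝ × ℝ} (hx : 0 < x.2) (hy : 0 < y.2) : 0 ≤ greenG x y := by
  unfold greenG sqdist
  have : 0 ≤ 4 * x.2 * y.2 / ((x.1 - y.1) ^ 2 + (x.2 - y.2) ^ 2) := by positivity
  exact mul_nonneg (by positivity) (Real.log_nonneg (by linarith))

theorem greenG_symm (x y : ℝ × ℝ) : greenG x y = greenG y x := by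
  unfold greenG sqdist
  congr 3
  ring

theorem greenG_le {q : ℝ} (hq : 0 < q) {x y : ℝ × ℝ} (hx : 0 < x.2) (hy : 0 < y.2)
    (hxy : x.1 ≠ y.1) : greenG x y ≤ (4 * π)⁻¹ * (4 * y.2 + 2 * hAux q x y) := by
  unfold greenG
  refine mul_le_mul_of_nonneg_left ?_ (by positivity)
  have hs : 0 < |x.1 - y.1| := abs_pos.2 (sub_ne_zero.2 hxy)
  have hsq : 0 < sqdist x y := by
    unfold sqdist
    have := sq_pos_of_pos hs
    rw [sq_abs] at this
    positivity
  obtain ⟨d, hd⟩ : ∃ d, d = Real.sqrt (sqdist x y) := ⟨_, rfl⟩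
  have hd0 : 0 < d := hd ▸ Real.sqrt_pos.2 hsq
  have hd2 : sqdist x y = d ^ 2 := by rw [hd, Real.sq_sqrt hsq.le]
  have hsd : |x.1 - y.1| ≤ d := by
    refine abs_le_of_sq_le_sq ?_ hd0.le
    rw [← hd2]; unfold sqdist; nlinarith [sq_nonneg (x.2 - y.2)]
  have htd : |x.2 - y.2| ≤ d := by
    refine abs_le_of_sq_le_sq ?_ hd0.le
    rw [← hd2]; unfold sqdist; nlinarith [sq_nonneg (x.1 - y.1)]
  have hx2 : x.2 ≤ y.2 + d := by linarith [le_abs_self (x.2 - y.2)]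
  have h1 : 1 + 4 * x.2 * y.2 / sqdist x y ≤ (1 + 2 * y.2 / d) ^ 2 := by
    rw [hd2]
    have : (1 + 2 * y.2 / d) ^ 2 = 1 + 4 * (y.2 + d) * y.2 / d ^ 2 := by
      field_simp; ring
    rw [this]
    gcongr
  have h2 : Real.log (1 + 4 * x.2 * y.2 / sqdist x y) ≤ 2 * Real.log (1 + 2 * y.2 / d) := by
    have h3 := Real.log_le_log (by positivity) h1
    rw [Real.log_pow] at h3
    exact_mod_cast h3
  have hh := hAux_nonneg hq x y
  rcases le_or_gt 1 d with h | h
  · have h3 : Real.log (1 + 2 * y.2 / d) ≤ 2 * y.2 / d := by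
      have := Real.log_le_sub_one_of_pos (x := 1 + 2 * y.2 / d) (by positivity)
      linarith
    have h4 : 2 * y.2 / d ≤ 2 * y.2 := div_le_self (by positivity) h
    linarith
  · have e : hAux q x y = 2 * q * |x.1 - y.1| ^ (-(1 / (2 * q))) := by
      unfold hAux
      rw [if_pos ⟨by linarith, by linarith⟩]
    have h3 : Real.log (1 + 2 * y.2 / d) ≤ Real.log ((1 + 2 * y.2) * d⁻¹) := by
      apply Real.log_le_log (by positivity)
      have : 1 ≤ d⁻¹ := (one_le_inv₀ hd0).2 h.le
      rw [div_eq_mul_inv]; linarith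
    rw [Real.log_mul (by positivity) (by positivity)] at h3
    have h4 : Real.log (1 + 2 * y.2) ≤ 2 * y.2 := by
      have := Real.log_le_sub_one_of_pos (x := 1 + 2 * y.2) (by positivity)
      linarith
    have h5 : Real.log d⁻¹ ≤ Real.log (|x.1 - y.1|⁻¹) :=
      Real.log_le_log (by positivity) (inv_anti₀ hs hsd)
    have h6 := Real.log_le_rpow_div (x := |x.1 - y.1|⁻¹) (ε := 1 / (2 * q)) (by positivity)
      (by positivity)
    have h7 : (|x.1 - y.1|⁻¹) ^ (1 / (2 * q)) / (1 / (2 * q)) = hAux q x y := by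
      rw [e, Real.inv_rpow (abs_nonneg _), Real.rpow_neg (abs_nonneg _)]
      field_simp
    linarith

theorem greenG_measurable : Measurable (fun z : (ℝ × ℝ) × (ℝ × ℝ) => greenG z.1 z.2) := by
  unfold greenG sqdist
  fun_prop

theorem ae_pos : ∀ᵐ y ∂μUH, 0 < y.2 := by
  unfold μUH
  have hm : MeasurableSet UHP := measurableSet_lt measurable_const measurable_snd
  filter_upwards [ae_restrict_mem hm] with y hy using hy

theorem ae_ne (a : ℝ) : ∀ᵐ y ∂μUH, a ≠ y.1 := by
  unfold μUH
  apply ae_restrict_of_ae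
  have h : ∀ᵐ s : ℝ, s ≠ a := by
    simp [ae_iff]
  have := (Measure.quasiMeasurePreserving_fst (μ := (volume : Measure ℝ))
    (ν := (volume : Measure ℝ))).ae h
  filter_upwards [this] with y hy using hy.symm

instance instSFiniteUH : SFinite μUH := by unfold μUH; infer_instance

/-- Class of admissible functions. -/
structure Adm (p L : ℝ) (ξ : ℝ × ℝ → ℝ) : Prop where
  nn : ∀ x, 0 ≤ ξ x
  int : Integrable ξ μUH
  mem : MemLp ξ (ENNReal.ofReal p) μUH
  intI : Integrable (fun y => ξ y * y.2) μUH
  imp : impulse ξ ≤ L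
  lp : lpN p ξ ≤ L

theorem Adm.rpow {p L : ℝ} (hp : 1 < p) (hL : 0 < L) {ξ : ℝ × ℝ → ℝ} (h : Adm p L ξ) :
    Integrable (fun y => ξ y ^ p) μUH ∧ ∫ y, ξ y ^ p ∂μUH ≤ L ^ p := by
  have hp0 : 0 < p := by linarith
  have e0 : ENNReal.ofReal p ≠ 0 := by simpa using hp0
  have e1 : (ENNReal.ofReal p).toReal = p := ENNReal.toReal_ofReal hp0.le
  have hi := h.mem.integrable_norm_rpow e0 ENNReal.ofReal_ne_top
  have hn := h.mem.eLpNorm_eq_integral_rpow_norm e0 ENNReal.ofReal_ne_top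
  simp only [e1, Real.norm_of_nonneg (h.nn _)] at hi hn
  refine ⟨hi, ?_⟩
  have hnn : 0 ≤ ∫ y, ξ y ^ p ∂μUH := integral_nonneg fun y => Real.rpow_nonneg (h.nn y) _
  have hl := h.lp
  unfold lpN at hl
  rw [hn, ENNReal.toReal_ofReal (by positivity)] at hl
  have := Real.rpow_le_rpow (by positivity) hl hp0.le
  rwa [← Real.rpow_mul hnn, inv_mul_cancel₀ hp0.ne', Real.rpow_one] at this

/-- The uniform bound of the stream function. -/
def CC (p L : ℝ) : ℝ :=
  (4 * π)⁻¹ * (4 * L + 2 * (L ^ p / p + (2 * p.conjExponent) ^ p.conjExponent / p.conjExponent *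
    ∫ y : ℝ × ℝ, phiAux y.1 * psiAux y.2))

theorem Adm.bound {p L : ℝ} (hp : 1 < p) (hL : 0 < L) {ξ : ℝ × ℝ → ℝ} (h : Adm p L ξ)
    {x : ℝ × ℝ} (hx : 0 < x.2) :
    Integrable (fun y => greenG x y * ξ y) μUH ∧ 0 ≤ Gop ξ x ∧ Gop ξ x ≤ CC p L := by
  have hpq := Real.HolderConjugate.conjExponent hp
  unfold CC
  set q := p.conjExponent with hqd
  have hq : 0 < q := hpq.symm.pos
  obtain ⟨hr1, hr2⟩ := h.rpow hp hL
  have hk0 : Integrable (fun y : ℝ × ℝ => phiAux (x.1 - y.1) * psiAux (x.2 - y.2)) volume := by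
    have := phipsi_integrable.comp_sub_left x
    exact this
  have hke : ∫ y : ℝ × ℝ, phiAux (x.1 - y.1) * psiAux (x.2 - y.2) =
      ∫ y : ℝ × ℝ, phiAux y.1 * psiAux y.2 :=
    integral_sub_left_eq_self (fun y : ℝ × ℝ => phiAux y.1 * psiAux y.2) volume x
  have hk : Integrable (fun y : ℝ × ℝ => phiAux (x.1 - y.1) * psiAux (x.2 - y.2)) μUH :=
    hk0.restrict
  have hkl : ∫ y : ℝ × ℝ, phiAux (x.1 - y.1) * psiAux (x.2 - y.2) ∂μUH ≤
      ∫ y : ℝ × ℝ, phiAux y.1 * psiAux y.2 := by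
    rw [← hke]
    exact setIntegral_le_integral hk0 (Eventually.of_forall fun y => phipsi_nonneg (x - y))
  let R : ℝ × ℝ → ℝ := fun y => (4 * π)⁻¹ * (4 * (ξ y * y.2) + 2 * (p⁻¹ * ξ y ^ p +
    (2 * q) ^ q / q * (phiAux (x.1 - y.1) * psiAux (x.2 - y.2))))
  have hRi : Integrable R μUH :=
    ((h.intI.const_mul 4).add (((hr1.const_mul _).add (hk.const_mul _)).const_mul 2)).const_mul _
  have hRe : ∫ y, R y ∂μUH = (4 * π)⁻¹ * (4 * impulse ξ + 2 * (p⁻¹ * ∫ y, ξ y ^ p ∂μUH +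
    (2 * q) ^ q / q * ∫ y : ℝ × ℝ, phiAux (x.1 - y.1) * psiAux (x.2 - y.2) ∂μUH)) := by
    have j1 : Integrable (fun y => p⁻¹ * ξ y ^ p +
        (2 * q) ^ q / q * (phiAux (x.1 - y.1) * psiAux (x.2 - y.2))) μUH :=
      (hr1.const_mul _).add (hk.const_mul _)
    simp only [R]
    rw [integral_const_mul, integral_add (h.intI.const_mul 4)
      (j1.const_mul 2), integral_const_mul,
      integral_const_mul, integral_add (hr1.const_mul _) (hk.const_mul _), integral_const_mul,
      integral_const_mul, impulse]
  have hle : ∀ᵐ y ∂μUH, greenG x y * ξ y ≤ R y := by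
    filter_upwards [ae_pos, ae_ne x.1] with y hy hne
    have a1 := mul_le_mul_of_nonneg_right (greenG_le hq hx hy hne) (h.nn y)
    have a2 := Real.young_inequality_of_nonneg (h.nn y) (hAux_nonneg hq x y) hpq
    rw [hAux_rpow hq] at a2
    refine a1.trans ?_
    simp only [R]
    rw [mul_assoc]
    refine mul_le_mul_of_nonneg_left ?_ (by positivity)
    have a3 : ξ y ^ p / p = p⁻¹ * ξ y ^ p := by ring
    have a4 : (2 * q) ^ q * (phiAux (x.1 - y.1) * psiAux (x.2 - y.2)) / q =
      (2 * q) ^ q / q * (phiAux (x.1 - y.1) * psiAux (x.2 - y.2)) := by ring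
    rw [a3, a4] at a2
    linarith
  have hnn : ∀ᵐ y ∂μUH, 0 ≤ greenG x y * ξ y := by
    filter_upwards [ae_pos] with y hy using mul_nonneg (greenG_nonneg hx hy) (h.nn y)
  have hint : Integrable (fun y => greenG x y * ξ y) μUH := by
    refine hRi.mono' ?_ ?_
    · exact (greenG_measurable.comp (measurable_const.prodMk measurable_id)).aestronglyMeasurable.mul
        h.int.1
    · filter_upwards [hle, hnn] with y h1 h2
      rwa [Real.norm_of_nonneg h2]
  refine ⟨hint, integral_nonneg_of_ae hnn, ?_⟩
  refine (integral_mono_ae hint hRi hle).trans ?_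
  rw [hRe]
  have h1 := h.imp
  have hpp : 0 < p := by linarith
  have e : L ^ p / p = p⁻¹ * L ^ p := by ring
  rw [e]
  gcongr

theorem Adm.prod_int {p L : ℝ} (hp : 1 < p) (hL : 0 < L) {ξ η : ℝ × ℝ → ℝ} (hξ : Adm p L ξ)
    (hη : Adm p L η) :
    Integrable (fun z : (ℝ × ℝ) × (ℝ × ℝ) => ξ z.1 * (greenG z.1 z.2 * η z.2))
      (μUH.prod μUH) := by
  have hm : AEStronglyMeasurable
      (fun z : (ℝ × ℝ) × (ℝ × ℝ) => ξ z.1 * (greenG z.1 z.2 * η z.2)) (μUH.prod μUH) :=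
    hξ.int.1.comp_fst.mul (greenG_measurable.aestronglyMeasurable.mul hη.int.1.comp_snd)
  rw [integrable_prod_iff hm]
  constructor
  · filter_upwards [ae_pos] with x hx
    exact (hη.bound hp hL hx).1.const_mul _
  · refine (hξ.int.mul_const (CC p L)).mono' hm.norm.integral_prod_right' ?_
    filter_upwards [ae_pos] with x hx
    obtain ⟨h1, h2, h3⟩ := hη.bound hp hL hx
    have e : ∫ y, ‖ξ x * (greenG x y * η y)‖ ∂μUH = ξ x * Gop η x := by
      unfold Gop
      rw [← integral_const_mul]
      apply integral_congr_ae
      filter_upwards [ae_pos] with y hy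
      exact Real.norm_of_nonneg
        (mul_nonneg (hξ.nn x) (mul_nonneg (greenG_nonneg hx hy) (hη.nn y)))
    rw [e, Real.norm_of_nonneg (mul_nonneg (hξ.nn x) h2)]
    exact mul_le_mul_of_nonneg_left h3 (hξ.nn x)

theorem Adm.int1 {p L : ℝ} (hp : 1 < p) (hL : 0 < L) {ξ η : ℝ × ℝ → ℝ} (hξ : Adm p L ξ)
    (hη : Adm p L η) : Integrable (fun x => ξ x * Gop η x) μUH := by
  have := (hξ.prod_int hp hL hη).integral_prod_left
  simpa only [integral_const_mul, Gop] using this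

theorem Adm.symm {p L : ℝ} (hp : 1 < p) (hL : 0 < L) {ξ η : ℝ × ℝ → ℝ} (hξ : Adm p L ξ)
    (hη : Adm p L η) : ∫ x, ξ x * Gop η x ∂μUH = ∫ x, η x * Gop ξ x ∂μUH := by
  unfold Gop
  simp only [← integral_const_mul]
  rw [integral_integral_swap (f := fun x y => ξ x * (greenG x y * η y)) (hξ.prod_int hp hL hη)]
  congr 1
  ext y
  congr 1
  ext x
  rw [greenG_symm]
  ring

/-- Lemma 4: Lipschitz continuity of the energy in `L¹` on bounded classes. -/
theorem stmt_3 (p L : ℝ) (hp : 1 < p) (hL : 0 < L) :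
    ∃ K : ℝ, ∀ ξ η : ℝ × ℝ → ℝ,
      (∀ x, 0 ≤ ξ x) → Integrable ξ μUH → MemLp ξ (ENNReal.ofReal p) μUH →
      Integrable (fun y => ξ y * y.2) μUH →
      impulse ξ ≤ L → lpN 1 ξ ≤ L → lpN p ξ ≤ L →
      (∀ x, 0 ≤ η x) → Integrable η μUH → MemLp η (ENNReal.ofReal p) μUH →
      Integrable (fun y => η y * y.2) μUH →
      impulse η ≤ L → lpN 1 η ≤ L → lpN p η ≤ L →
      |energy ξ - energy η| ≤ K * lpN 1 (fun x => ξ x - η x) := by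
  refine ⟨CC p L, ?_⟩
  intro ξ η a1 a2 a3 a4 a5 a6 a7 b1 b2 b3 b4 b5 b6 b7
  have hξ : Adm p L ξ := ⟨a1, a2, a3, a4, a5, a7⟩
  have hη : Adm p L η := ⟨b1, b2, b3, b4, b5, b7⟩
  have hd : Integrable (fun x => ξ x - η x) μUH := a2.sub b2
  have hl : lpN 1 (fun x => ξ x - η x) = ∫ x, ‖ξ x - η x‖ ∂μUH := by
    unfold lpN
    rw [ENNReal.ofReal_one, eLpNorm_one_eq_lintegral_enorm, integral_norm_eq_lintegral_enorm hd.1]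
  have i1 := hξ.int1 hp hL hξ
  have i2 := hξ.int1 hp hL hη
  have i3 := hη.int1 hp hL hξ
  have i4 := hη.int1 hp hL hη
  have e : energy ξ - energy η =
      (1 / 2) * ∫ x, (ξ x - η x) * (Gop ξ x + Gop η x) ∂μUH := by
    have e1 : (fun x => (ξ x - η x) * (Gop ξ x + Gop η x)) = fun x =>
        (ξ x * Gop ξ x + ξ x * Gop η x) - (η x * Gop ξ x + η x * Gop η x) := by
      ext x; ring
    have j1 : Integrable (fun x => ξ x * Gop ξ x + ξ x * Gop η x) μUH := i1.add i2
    have j2 : Integrable (fun x => η x * Gop ξ x + η x * Gop η x) μUH := i3.add i4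
    rw [e1, integral_sub j1 j2, integral_add i1 i2, integral_add i3 i4,
      hξ.symm hp hL hη]
    unfold energy
    ring
  rw [e, hl, abs_mul, abs_of_pos (by norm_num : (0 : ℝ) < 1 / 2)]
  have hb : ‖∫ x, (ξ x - η x) * (Gop ξ x + Gop η x) ∂μUH‖ ≤
      ∫ x, 2 * CC p L * ‖ξ x - η x‖ ∂μUH := by
    apply norm_integral_le_of_norm_le (hd.norm.const_mul _)
    filter_upwards [ae_pos] with x hx
    obtain ⟨-, h2, h3⟩ := hξ.bound hp hL hx
    obtain ⟨-, h5, h6⟩ := hη.bound hp hL hx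
    rw [norm_mul, Real.norm_of_nonneg (add_nonneg h2 h5), mul_comm]
    exact mul_le_mul_of_nonneg_right (by linarith) (norm_nonneg _)
  rw [integral_const_mul, Real.norm_eq_abs] at hb
  linarith
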